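/- arXiv:2409.18886 — 2 statements merged into one kernel-verified Lean document; each statement's English description precedes it below -/
import Mathlib

section
/- Let s be a positive integer. If the sequence of real polynomials (f_k(q))_{k≥0} is strongly q-log-concave, then the bi^s-nomial transform B_n(q) = Σ_{k=0}^{sn} C_s(n,k) f_k(q), n ≥ 0, is also strongly q-log-concave. -/
open Polynomial

/-- The bi^s-nomial coefficient `C_s(n,k)`: the coefficient of `x^k` in
`(1 + x + ⋯ + x^s)^n`. -/
noncomputable def bisnomial (s n k : ℕ) : ℝ :=
  (((∑ i ∈ Finset.range (s + 1), (X : ℝ[X]) ^ i) ^ n).coeff k)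

open TensorProduct

section SchurCone

variable {R : Type*} [CommRing R] (x y : R)

/-- The complete homogeneous symmetric polynomial of degree `n` in two variables,
evaluated at `x` and `y`. -/
def completeHomog (n : ℕ) : R := ∑ i ∈ Finset.range (n + 1), x ^ i * y ^ (n - i)

/-- The additive monoid generated by the two-variable Schur polynomials
`(x * y) ^ a * h_b(x, y)`. -/
def schurCone : AddSubmonoid R :=
  AddSubmonoid.closure {z | ∃ a b : ℕ, z = (x * y) ^ a * completeHomog x y b}

@[simp]
lemma completeHomog_zero : completeHomog x y 0 = 1 := by simp [completeHomog]

lemma completeHomog_succ (n : ℕ) :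
    completeHomog x y (n + 1) = x ^ (n + 1) + y * completeHomog x y n := by
  simpa [completeHomog] using geom_sum₂_succ_eq x y (n := n + 1)

lemma completeHomog_succ' (n : ℕ) :
    completeHomog x y (n + 1) = y ^ (n + 1) + x * completeHomog x y n := by
  induction n with
  | zero => simp [completeHomog_succ, add_comm]
  | succ n ih =>
    linear_combination completeHomog_succ x y (n + 1) + y * ih - x * completeHomog_succ x y n

lemma completeHomog_add_succ (a b : ℕ) :
    completeHomog x y (a + b + 1) =
      x ^ (b + 1) * completeHomog x y a + y ^ (a + 1) * completeHomog x y b := by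
  induction a with
  | zero => simp [completeHomog_succ]
  | succ a ih =>
    rw [show a + 1 + b + 1 = (a + b + 1) + 1 by ring, completeHomog_succ, ih, completeHomog_succ]
    ring

lemma completeHomog_succ_mul_succ (a b : ℕ) :
    completeHomog x y (a + 1) * completeHomog x y (b + 1) =
      completeHomog x y (a + b + 2) + x * y * (completeHomog x y a * completeHomog x y b) := by
  have h := completeHomog_add_succ x y a (b + 1)
  rw [show a + b + 2 = a + (b + 1) + 1 by ring, h, completeHomog_succ' x y a,
    completeHomog_succ x y b]
  ring

lemma sub_mul_completeHomog (n : ℕ) :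
    (x - y) * completeHomog x y n = x ^ (n + 1) - y ^ (n + 1) := by
  linear_combination completeHomog_succ x y n - completeHomog_succ' x y n

lemma pow_mul_completeHomog_mem (a b : ℕ) :
    (x * y) ^ a * completeHomog x y b ∈ schurCone x y :=
  AddSubmonoid.subset_closure ⟨a, b, rfl⟩

lemma completeHomog_mem (b : ℕ) : completeHomog x y b ∈ schurCone x y := by
  simpa using pow_mul_completeHomog_mem x y 0 b

lemma one_mem_schurCone : (1 : R) ∈ schurCone x y := by
  simpa using completeHomog_mem x y 0

lemma mul_mem_schurCone_self : x * y ∈ schurCone x y := by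
  simpa using pow_mul_completeHomog_mem x y 1 0

lemma pow_mul_completeHomog_mul_mem (k a b : ℕ) :
    (x * y) ^ k * (completeHomog x y a * completeHomog x y b) ∈ schurCone x y := by
  induction a generalizing k b with
  | zero => simpa using pow_mul_completeHomog_mem x y k b
  | succ a ih =>
    cases b with
    | zero => simpa using pow_mul_completeHomog_mem x y k (a + 1)
    | succ b =>
      rw [completeHomog_succ_mul_succ, mul_add, ← mul_assoc _ (x * y), ← pow_succ]
      exact add_mem (pow_mul_completeHomog_mem x y k _) (ih (k + 1) b)

variable {x y}

lemma mul_mem_schurCone {u v : R} (hu : u ∈ schurCone x y) (hv : v ∈ schurCone x y) :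
    u * v ∈ schurCone x y := by
  unfold schurCone at hu hv
  induction hu, hv using AddSubmonoid.closure_induction₂ with
  | mem u v hu hv =>
    obtain ⟨a, b, rfl⟩ := hu
    obtain ⟨c, d, rfl⟩ := hv
    rw [mul_mul_mul_comm, ← pow_add]
    exact pow_mul_completeHomog_mul_mem x y (a + c) b d
  | zero_left => simp
  | zero_right => simp
  | add_left u v w _ _ _ h₁ h₂ => rw [add_mul]; exact add_mem h₁ h₂
  | add_right u v w _ _ _ h₁ h₂ => rw [mul_add]; exact add_mem h₁ h₂

lemma pow_mem_schurCone {u : R} (hu : u ∈ schurCone x y) (n : ℕ) : u ^ n ∈ schurCone x y := by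
  induction n with
  | zero => simpa using one_mem_schurCone x y
  | succ n ih => rw [pow_succ]; exact mul_mem_schurCone ih hu

variable (x y)

/-- Divided differences of polynomials with natural coefficients are Schur positive. -/
lemma exists_aeval_sub_aeval_eq (p : ℕ[X]) :
    ∃ e ∈ schurCone x y, aeval x p - aeval y p = (x - y) * e := by
  induction p using Polynomial.induction_on' with
  | add p q hp hq =>
    obtain ⟨e, he, hpe⟩ := hp
    obtain ⟨e', he', hqe⟩ := hq
    refine ⟨e + e', add_mem he he', ?_⟩
    rw [map_add, map_add]
    linear_combination hpe + hqe
  | monomial n c =>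
    cases n with
    | zero => exact ⟨0, zero_mem _, by simp⟩
    | succ n =>
      refine ⟨c • completeHomog x y n, nsmul_mem (completeHomog_mem x y n) c, ?_⟩
      simp only [aeval_monomial, nsmul_eq_mul, eq_natCast]
      linear_combination -(c : R) * sub_mul_completeHomog x y n

lemma exists_geom_sum_pow_sub_eq (s d : ℕ) :
    ∃ e ∈ schurCone x y,
      (∑ i ∈ Finset.range s, x ^ i) ^ d - (∑ i ∈ Finset.range s, y ^ i) ^ d = (x - y) * e := by
  simpa using exists_aeval_sub_aeval_eq x y ((∑ i ∈ Finset.range s, X ^ i) ^ d)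

lemma sum_completeHomog (s : ℕ) :
    ∑ b ∈ Finset.range (s + 2), completeHomog x y b =
      x * y * ∑ b ∈ Finset.range s, completeHomog x y b +
        (∑ i ∈ Finset.range (s + 2), x ^ i + ∑ i ∈ Finset.range (s + 2), y ^ i - 1) := by
  induction s with
  | zero =>
    simp only [zero_add, Finset.sum_range_succ, completeHomog_succ x y 0, completeHomog_zero,
      Finset.range_zero, Finset.sum_empty]
    ring
  | succ s ih =>
    rw [show s + 1 + 2 = (s + 2) + 1 by ring, Finset.sum_range_succ, ih,
      Finset.sum_range_succ _ s, Finset.sum_range_succ _ (s + 2),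
      Finset.sum_range_succ _ (s + 2), completeHomog_succ, completeHomog_succ']
    ring

lemma exists_geom_sum_mul_geom_sum_eq (s : ℕ) :
    ∃ e ∈ schurCone x y,
      (∑ i ∈ Finset.range (s + 1), x ^ i) * (∑ i ∈ Finset.range (s + 1), y ^ i) =
        ∑ b ∈ Finset.range (s + 1), completeHomog x y b + e := by
  induction s with
  | zero => exact ⟨0, zero_mem _, by simp⟩
  | succ s ih =>
    obtain ⟨e, he, h⟩ := ih
    refine ⟨x * y * (completeHomog x y s + e), mul_mem_schurCone (mul_mem_schurCone_self x y)
      (add_mem (completeHomog_mem x y s) he), ?_⟩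
    have hx := geom_sum_succ (x := x) (n := s + 1)
    have hy := geom_sum_succ (x := y) (n := s + 1)
    have hc := Finset.sum_range_succ (completeHomog x y) s
    rw [sum_completeHomog, hx, hy]
    linear_combination x * y * (h + hc)

lemma geom_sum_mul_geom_sum_mem (s : ℕ) :
    (∑ i ∈ Finset.range (s + 1), x ^ i) * (∑ i ∈ Finset.range (s + 1), y ^ i) ∈
      schurCone x y := by
  obtain ⟨e, he, h⟩ := exists_geom_sum_mul_geom_sum_eq x y s
  rw [h]
  exact add_mem (sum_mem fun b _ => completeHomog_mem x y b) he

end SchurCone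

/-- The linear map `ℝ[X] → ℝ[X]` sending `X ^ k` to `f k`. -/
noncomputable def umbralMap (f : ℕ → ℝ[X]) : ℝ[X] →ₗ[ℝ] ℝ[X] :=
  Polynomial.lsum fun k => LinearMap.toSpanSingleton ℝ ℝ[X] (f k)

lemma umbralMap_X_pow (f : ℕ → ℝ[X]) (k : ℕ) : umbralMap f (X ^ k) = f k := by
  simp [umbralMap, ← monomial_one_right_eq_X_pow, sum_monomial_index]

lemma umbralMap_eq_sum_range (f : ℕ → ℝ[X]) {p : ℝ[X]} {n : ℕ} (hn : p.natDegree < n) :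
    umbralMap f p = ∑ k ∈ Finset.range n, C (p.coeff k) * f k := by
  simp [umbralMap, sum_over_range' p _ n hn, smul_eq_C_mul]

/-- The linear map on `ℝ[X] ⊗ ℝ[X]` sending `X ^ i ⊗ X ^ j` to `f i * f j`. -/
noncomputable def umbralMap₂ (f : ℕ → ℝ[X]) : ℝ[X] ⊗[ℝ] ℝ[X] →ₗ[ℝ] ℝ[X] :=
  LinearMap.mul' ℝ ℝ[X] ∘ₗ TensorProduct.map (umbralMap f) (umbralMap f)

lemma umbralMap₂_tmul (f : ℕ → ℝ[X]) (p q : ℝ[X]) :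
    umbralMap₂ f (p ⊗ₜ q) = umbralMap f p * umbralMap f q := by
  simp [umbralMap₂]

lemma umbralMap₂_pow_mul_pow (f : ℕ → ℝ[X]) (p q : ℝ[X]) (i j : ℕ) :
    umbralMap₂ f ((p ⊗ₜ 1) ^ i * (1 ⊗ₜ q) ^ j) = umbralMap f (p ^ i) * umbralMap f (q ^ j) := by
  simp [Algebra.TensorProduct.tmul_pow, umbralMap₂_tmul]

/-- The value of `umbralMap₂ f` at `(u * v) ^ a * ((u - v) * (u ^ (d + 1) - v ^ (d + 1)))`,
where `u = p ⊗ 1` and `v = 1 ⊗ p`. -/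
lemma umbralMap₂_symm_diff (f : ℕ → ℝ[X]) (p : ℝ[X]) (a d : ℕ) :
    umbralMap₂ f (((p ⊗ₜ 1) * (1 ⊗ₜ p)) ^ a * (((p ⊗ₜ 1) - (1 ⊗ₜ p)) *
        ((p ⊗ₜ 1) ^ (d + 1) - (1 ⊗ₜ p) ^ (d + 1)))) =
      C (-2) * (umbralMap f (p ^ (a + 1)) * umbralMap f (p ^ (a + d + 1)) -
        umbralMap f (p ^ a) * umbralMap f (p ^ (a + d + 2))) := by
  have expand (u v : ℝ[X] ⊗[ℝ] ℝ[X]) :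
      (u * v) ^ a * ((u - v) * (u ^ (d + 1) - v ^ (d + 1))) =
        u ^ (a + d + 2) * v ^ a - u ^ (a + 1) * v ^ (a + d + 1) -
          u ^ (a + d + 1) * v ^ (a + 1) + u ^ a * v ^ (a + d + 2) := by
    ring
  rw [expand, map_add, map_sub, map_sub]
  simp only [umbralMap₂_pow_mul_pow, map_neg, map_ofNat]
  ring

lemma coeff_umbralMap₂_nonpos {f : ℕ → ℝ[X]}
    (hf : ∀ m n : ℕ, 1 ≤ n → n ≤ m → ∀ t : ℕ,
      0 ≤ (f n * f m - f (n - 1) * f (m + 1)).coeff t)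
    {e : ℝ[X] ⊗[ℝ] ℝ[X]} (he : e ∈ schurCone ((X : ℝ[X]) ⊗ₜ[ℝ] (1 : ℝ[X])) (1 ⊗ₜ X)) (t : ℕ) :
    (umbralMap₂ f ((X ⊗ₜ 1 - 1 ⊗ₜ X) ^ 2 * e)).coeff t ≤ 0 := by
  unfold schurCone at he
  induction he using AddSubmonoid.closure_induction with
  | mem e he =>
    obtain ⟨a, b, rfl⟩ := he
    have key := umbralMap₂_symm_diff f X a b
    rw [← sub_mul_completeHomog] at key
    rw [show ∀ z w h : ℝ[X] ⊗[ℝ] ℝ[X], z ^ 2 * (w * h) = w * (z * (z * h)) by intros; ring, key]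
    have := hf (a + b + 1) (a + 1) (by omega) (by omega) t
    rw [Nat.add_sub_cancel] at this
    simp only [umbralMap_X_pow]
    rw [coeff_C_mul]
    linarith
  | zero => simp
  | add u v _ _ hu hv =>
    rw [mul_add, map_add, coeff_add]
    exact add_nonpos hu hv

lemma natDegree_geom_sum_pow_le (s n : ℕ) :
    ((∑ i ∈ Finset.range (s + 1), (X : ℝ[X]) ^ i) ^ n).natDegree ≤ s * n := by
  rw [mul_comm]
  refine natDegree_pow_le_of_le n (natDegree_sum_le_of_forall_le _ _ fun i hi => ?_)
  rw [natDegree_X_pow]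
  exact Finset.mem_range_succ_iff.mp hi

/-- The bi^s-nomial transformation preserves strong `q`-log-concavity. -/
theorem stmt_10 (s : ℕ) (hs : 1 ≤ s) (f : ℕ → ℝ[X])
    (hf : ∀ m n : ℕ, 1 ≤ n → n ≤ m → ∀ t : ℕ,
      0 ≤ (f n * f m - f (n - 1) * f (m + 1)).coeff t)
    (B : ℕ → ℝ[X])
    (hB : ∀ n : ℕ, B n = ∑ k ∈ Finset.range (s * n + 1), C (bisnomial s n k) * f k) :
    ∀ m n : ℕ, 1 ≤ n → n ≤ m → ∀ t : ℕ,
      0 ≤ (B n * B m - B (n - 1) * B (m + 1)).coeff t := by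
  intro m n hn hnm t
  obtain ⟨a, rfl⟩ := Nat.exists_eq_add_of_le' hn
  obtain ⟨d, rfl⟩ := Nat.exists_eq_add_of_le hnm
  set p : ℝ[X] := ∑ i ∈ Finset.range (s + 1), X ^ i with hp
  have hBp (k : ℕ) : B k = umbralMap f (p ^ k) := by
    rw [hB, umbralMap_eq_sum_range f (Nat.lt_succ_of_le (natDegree_geom_sum_pow_le s k))]
    rfl
  have hleft : p ⊗ₜ[ℝ] (1 : ℝ[X]) = ∑ i ∈ Finset.range (s + 1), (X ⊗ₜ 1) ^ i := by
    simp [hp, Algebra.TensorProduct.tmul_pow, sum_tmul]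
  have hright : (1 : ℝ[X]) ⊗ₜ[ℝ] p = ∑ i ∈ Finset.range (s + 1), (1 ⊗ₜ X) ^ i := by
    simp [hp, Algebra.TensorProduct.tmul_pow, tmul_sum]
  obtain ⟨e₁, he₁, h₁⟩ := exists_geom_sum_pow_sub_eq
    ((X : ℝ[X]) ⊗ₜ[ℝ] (1 : ℝ[X])) (1 ⊗ₜ X) (s + 1) 1
  obtain ⟨e₂, he₂, h₂⟩ := exists_geom_sum_pow_sub_eq
    ((X : ℝ[X]) ⊗ₜ[ℝ] (1 : ℝ[X])) (1 ⊗ₜ X) (s + 1) (d + 1)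
  have hprod := geom_sum_mul_geom_sum_mem ((X : ℝ[X]) ⊗ₜ[ℝ] (1 : ℝ[X])) (1 ⊗ₜ X) s
  rw [← hleft, ← hright] at h₁ h₂ hprod
  rw [pow_one, pow_one] at h₁
  have hneg := coeff_umbralMap₂_nonpos hf
    (mul_mem_schurCone (pow_mem_schurCone hprod a) (mul_mem_schurCone he₁ he₂)) t
  have key := umbralMap₂_symm_diff f p a d
  rw [h₁, h₂] at key
  rw [show ∀ z w u v : ℝ[X] ⊗[ℝ] ℝ[X], z ^ 2 * (w * (u * v)) = w * (z * u * (z * v)) by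
      intros; ring, key, coeff_C_mul] at hneg
  rw [hBp, hBp, hBp, hBp, Nat.add_sub_cancel, show a + 1 + d = a + d + 1 by ring]
  linarith
end

section
/- Define the Motzkin triangle [M_{n,k}]_{n,k≥0} by M_{0,0} = 1, M_{0,k} = 0 for k > 0, and for n ≥ 1: M_{n,0} = M_{n-1,0} + M_{n-1,1} and M_{n,k} = M_{n-1,k-1} + M_{n-1,k} + M_{n-1,k+1} for k ≥ 1 (entries with k > n being zero). Then the row generating functions M_n(q) = Σ_{k=0}^{n} M_{n,k} q^k, n ≥ 0, form a strongly q-log-convex sequence. -/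
open Polynomial

/-- The Motzkin triangle: `M 0 0 = 1`, `M 0 k = 0` for `k > 0`,
`M n 0 = M (n-1) 0 + M (n-1) 1` and
`M n k = M (n-1) (k-1) + M (n-1) k + M (n-1) (k+1)` for `k ≥ 1`. -/
def motzkinTriangle : ℕ → ℕ → ℝ
  | 0, 0 => 1
  | 0, _ + 1 => 0
  | n + 1, 0 => motzkinTriangle n 0 + motzkinTriangle n 1
  | n + 1, k + 1 => motzkinTriangle n k + motzkinTriangle n (k + 1) + motzkinTriangle n (k + 2)

/-- The generating function of the `n`-th row of the Motzkin triangle. -/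
noncomputable def motzkinRowGF (n : ℕ) : ℝ[X] :=
  ∑ k ∈ Finset.range (n + 1), C (motzkinTriangle n k) * X ^ k

theorem motzkinTriangle_nonneg (n k : ℕ) : 0 ≤ motzkinTriangle n k := by
  induction n generalizing k with
  | zero => cases k <;> simp [motzkinTriangle]
  | succ n ih =>
    cases k with
    | zero => exact add_nonneg (ih _) (ih _)
    | succ k => exact add_nonneg (add_nonneg (ih _) (ih _)) (ih _)

theorem motzkinTriangle_eq_zero_of_lt {n k : ℕ} (h : n < k) : motzkinTriangle n k = 0 := by
  induction n generalizing k with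
  | zero =>
    obtain ⟨k, rfl⟩ := Nat.exists_eq_succ_of_ne_zero h.ne'
    rfl
  | succ n ih =>
    obtain ⟨k, rfl⟩ := Nat.exists_eq_succ_of_ne_zero (by lia : k ≠ 0)
    simp [motzkinTriangle, ih (show n < k by lia), ih (show n < k + 1 by lia),
      ih (show n < k + 2 by lia)]

/-- The `2 × 2` minors of the Motzkin triangle are nonnegative. -/
theorem motzkinTriangle_minor_nonneg {n m i j : ℕ} (hnm : n ≤ m) (hij : i ≤ j) :
    motzkinTriangle n j * motzkinTriangle m i ≤ motzkinTriangle n i * motzkinTriangle m j := by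
  induction n generalizing m i j with
  | zero =>
    obtain rfl | h := hij.eq_or_lt
    · exact le_rfl
    · rw [motzkinTriangle_eq_zero_of_lt (show 0 < j by lia), zero_mul]
      exact mul_nonneg (motzkinTriangle_nonneg _ _) (motzkinTriangle_nonneg _ _)
  | succ n ih =>
    obtain ⟨m, rfl⟩ := Nat.exists_eq_succ_of_ne_zero (by lia : m ≠ 0)
    have D {a b : ℕ} (hab : a ≤ b) := ih (show n ≤ m by lia) hab
    obtain rfl | h := hij.eq_or_lt
    · exact le_rfl
    obtain ⟨d, rfl⟩ := Nat.exists_eq_add_of_lt h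
    cases i with
    | zero =>
      cases d with
      | zero =>
        simp only [motzkinTriangle, zero_add]
        linarith [D (show 0 ≤ 2 by lia), D (show 1 ≤ 2 by lia)]
      | succ d =>
        simp only [motzkinTriangle, zero_add]
        linarith [D (show 0 ≤ d + 1 by lia), D (show 0 ≤ d + 1 + 1 by lia),
          D (show 0 ≤ d + 1 + 2 by lia), D (show 1 ≤ d + 1 by lia),
          D (show 1 ≤ d + 1 + 1 by lia), D (show 1 ≤ d + 1 + 2 by lia)]
    | succ i =>
      cases d with
      | zero =>
        simp only [motzkinTriangle]
        linarith [D (show i ≤ i + 1 by lia), D (show i ≤ i + 1 + 1 by lia),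
          D (show i ≤ i + 1 + 2 by lia), D (show i + 1 ≤ i + 1 + 2 by lia),
          D (show i + 2 ≤ i + 1 + 2 by lia)]
      | succ d =>
        simp only [motzkinTriangle]
        linarith [D (show i ≤ i + 1 + (d + 1) by lia), D (show i ≤ i + 1 + (d + 1) + 1 by lia),
          D (show i ≤ i + 1 + (d + 1) + 2 by lia),
          D (show i + 1 ≤ i + 1 + (d + 1) by lia), D (show i + 1 ≤ i + 1 + (d + 1) + 1 by lia),
          D (show i + 1 ≤ i + 1 + (d + 1) + 2 by lia),
          D (show i + 2 ≤ i + 1 + (d + 1) by lia), D (show i + 2 ≤ i + 1 + (d + 1) + 1 by lia),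
          D (show i + 2 ≤ i + 1 + (d + 1) + 2 by lia)]

theorem coeff_motzkinRowGF (n k : ℕ) : (motzkinRowGF n).coeff k = motzkinTriangle n k := by
  simp only [motzkinRowGF, finsetSum_coeff, coeff_C_mul_X_pow, Finset.sum_ite_eq,
    Finset.mem_range]
  split_ifs with h
  · rfl
  · exact (motzkinTriangle_eq_zero_of_lt (by lia)).symm

theorem X_mul_motzkinRowGF_succ (n : ℕ) :
    X * motzkinRowGF (n + 1) =
      motzkinRowGF n + X * motzkinRowGF n + X * (X * motzkinRowGF n) -
        C (motzkinTriangle n 0) := by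
  ext k
  rcases k with _ | _ | k
  · simp [coeff_motzkinRowGF]
  · simp [coeff_motzkinRowGF, coeff_X_mul, motzkinTriangle, add_comm]
  · simp only [coeff_X_mul, coeff_sub, coeff_add, coeff_motzkinRowGF, motzkinTriangle,
      coeff_C_succ]
    ring

/-- The row generating functions of the Motzkin triangle form a strongly
`q`-log-convex sequence. -/
theorem stmt_14 :
    ∀ m n : ℕ, 1 ≤ n → n ≤ m → ∀ t : ℕ,
      0 ≤ (motzkinRowGF (n - 1) * motzkinRowGF (m + 1) -
            motzkinRowGF n * motzkinRowGF m).coeff t := by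
  intro m n hn hnm t
  obtain ⟨n, rfl⟩ := Nat.exists_eq_succ_of_ne_zero (by lia : n ≠ 0)
  have key : X * (motzkinRowGF n * motzkinRowGF (m + 1) -
      motzkinRowGF (n + 1) * motzkinRowGF m) =
      C (motzkinTriangle n 0) * motzkinRowGF m - C (motzkinTriangle m 0) * motzkinRowGF n := by
    linear_combination motzkinRowGF n * X_mul_motzkinRowGF_succ m -
      motzkinRowGF m * X_mul_motzkinRowGF_succ n
  have h := motzkinTriangle_minor_nonneg (show n ≤ m by lia) (Nat.zero_le (t + 1))
  rw [Nat.succ_eq_add_one, Nat.add_sub_cancel, ← coeff_X_mul, key, coeff_sub, coeff_C_mul,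
    coeff_C_mul, coeff_motzkinRowGF, coeff_motzkinRowGF]
  linarith
end
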